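/- arXiv:1807.01223 — 4 statements merged into one kernel-verified Lean document; each statement's English description precedes it below -/
import Mathlib

section
/- Let n ≥ 1 and let λ₁, …, λ_{2n} ∈ ℂⁿ be vectors that are linearly independent over ℝ. Then the 2n vectors (λⱼ, conj(λⱼ)) ∈ ℂⁿ × ℂⁿ, for j = 1, …, 2n, where conj denotes componentwise complex conjugation, are linearly independent over ℂ (equivalently, they form a ℂ-basis of ℂⁿ × ℂⁿ). -/
/-- If `λ₁, …, λ_{2n} ∈ ℂⁿ` are linearly independent over `ℝ`, then the
vectors `(λⱼ, conj λⱼ) ∈ ℂⁿ × ℂⁿ` are linearly independent over `ℂ`, and hence form a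
`ℂ`-basis of `ℂⁿ × ℂⁿ`. -/
theorem stmt_0 (n : ℕ) (hn : 1 ≤ n) (lam : Fin (2 * n) → (Fin n → ℂ))
    (hlam : LinearIndependent ℝ lam) :
    LinearIndependent ℂ
        (fun j : Fin (2 * n) =>
          ((lam j, fun p => (starRingEnd ℂ) (lam j p)) : (Fin n → ℂ) × (Fin n → ℂ))) ∧
      Submodule.span ℂ
          (Set.range (fun j : Fin (2 * n) =>
            ((lam j, fun p => (starRingEnd ℂ) (lam j p)) : (Fin n → ℂ) × (Fin n → ℂ)))) =
        ⊤ := by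
  have key : LinearIndependent ℂ
        (fun j : Fin (2 * n) =>
          ((lam j, fun p => (starRingEnd ℂ) (lam j p)) : (Fin n → ℂ) × (Fin n → ℂ))) := by
    rw [Fintype.linearIndependent_iff] at hlam ⊢
    intro c hc
    have h1 : ∀ p, ∑ j, c j * lam j p = 0 := by
      intro p
      have := congrFun (congrArg Prod.fst hc) p
      simpa [Prod.fst_sum, Finset.sum_apply] using this
    have h2 : ∀ p, ∑ j, (starRingEnd ℂ) (c j) * lam j p = 0 := by
      intro p
      have := congrFun (congrArg Prod.snd hc) p
      have h3 : ∑ j, c j * (starRingEnd ℂ) (lam j p) = 0 := by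
        simpa [Prod.snd_sum, Finset.sum_apply] using this
      simpa [map_sum] using congrArg (starRingEnd ℂ) h3
    have hre := hlam (fun j => (c j).re) (by
      funext p
      have : ∑ j, ((c j).re : ℂ) * lam j p
          = (∑ j, c j * lam j p + ∑ j, (starRingEnd ℂ) (c j) * lam j p) / 2 := by
        rw [← Finset.sum_add_distrib, Finset.sum_div]
        refine Finset.sum_congr rfl fun j _ => ?_
        rw [Complex.re_eq_add_conj]; ring
      rw [h1, h2] at this
      simpa [Finset.sum_apply] using this)
    have him := hlam (fun j => (c j).im) (by
      funext p
      have : ∑ j, ((c j).im : ℂ) * lam j p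
          = (∑ j, c j * lam j p - ∑ j, (starRingEnd ℂ) (c j) * lam j p) / (2 * Complex.I) := by
        rw [← Finset.sum_sub_distrib, Finset.sum_div]
        refine Finset.sum_congr rfl fun j _ => ?_
        rw [Complex.im_eq_sub_conj]; ring
      rw [h1, h2] at this
      simpa [Finset.sum_apply] using this)
    exact fun j => Complex.ext (hre j) (him j)
  refine ⟨key, key.span_eq_top_of_card_eq_finrank' ?_⟩
  simp [two_mul]
end

section
/- Let n ≥ 1 and let λ₁, …, λ_{2n} ∈ ℂⁿ be vectors that are linearly independent over ℝ. Then the 2n vectors (λⱼ, −(i/2)·conj(λⱼ)) ∈ ℂⁿ × ℂⁿ, for j = 1, …, 2n, where conj denotes componentwise complex conjugation, are linearly independent over ℂ, and hence form a ℂ-basis of ℂⁿ × ℂⁿ ≅ ℂ^{2n}. -/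
/-- If `λ₁, …, λ_{2n} ∈ ℂⁿ` are linearly independent over `ℝ`, then the
vectors `(λⱼ, -(i/2)·conj λⱼ) ∈ ℂⁿ × ℂⁿ` are linearly independent over `ℂ`, and hence
form a `ℂ`-basis of `ℂⁿ × ℂⁿ`. -/
theorem stmt_1 (n : ℕ) (hn : 1 ≤ n) (lam : Fin (2 * n) → (Fin n → ℂ))
    (hlam : LinearIndependent ℝ lam) :
    LinearIndependent ℂ
        (fun j : Fin (2 * n) =>
          ((lam j, fun p => -(Complex.I / 2) * (starRingEnd ℂ) (lam j p)) :
            (Fin n → ℂ) × (Fin n → ℂ))) ∧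
      Submodule.span ℂ
          (Set.range (fun j : Fin (2 * n) =>
            ((lam j, fun p => -(Complex.I / 2) * (starRingEnd ℂ) (lam j p)) :
              (Fin n → ℂ) × (Fin n → ℂ)))) =
        ⊤ := by
  have key : LinearIndependent ℂ
        (fun j : Fin (2 * n) =>
          ((lam j, fun p => -(Complex.I / 2) * (starRingEnd ℂ) (lam j p)) :
            (Fin n → ℂ) × (Fin n → ℂ))) := by
    rw [Fintype.linearIndependent_iff] at hlam ⊢
    intro c hc
    have h1 : ∀ p, ∑ j, c j * lam j p = 0 := by
      intro p
      have := congrFun (congrArg Prod.fst hc) p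
      simpa [Prod.fst_sum, Finset.sum_apply] using this
    have h2 : ∀ p, ∑ j, (starRingEnd ℂ) (c j) * lam j p = 0 := by
      intro p
      have h := congrFun (congrArg Prod.snd hc) p
      simp only [Prod.snd_sum, Finset.sum_apply, Prod.smul_snd, Pi.smul_apply, smul_eq_mul,
        Prod.snd_zero, Pi.zero_apply] at h
      have h3 : -(Complex.I / 2) * ∑ j, c j * (starRingEnd ℂ) (lam j p) = 0 := by
        rw [← h, Finset.mul_sum]
        exact Finset.sum_congr rfl fun j _ => by ring
      have h4 : ∑ j, c j * (starRingEnd ℂ) (lam j p) = 0 := by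
        rcases mul_eq_zero.mp h3 with h | h
        · simp at h
        · exact h
      have h5 := congrArg (starRingEnd ℂ) h4
      simpa [map_sum] using h5
    have hre := hlam (fun j => (c j).re) (by
      funext p
      simp only [Finset.sum_apply, Pi.smul_apply, Complex.real_smul, Pi.zero_apply]
      have : ∑ j, ((c j).re : ℂ) * lam j p
          = (∑ j, c j * lam j p + ∑ j, (starRingEnd ℂ) (c j) * lam j p) / 2 := by
        rw [← Finset.sum_add_distrib, Finset.sum_div]
        refine Finset.sum_congr rfl fun j _ => ?_
        rw [Complex.re_eq_add_conj]; ring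
      rw [this, h1, h2]; simp)
    have him := hlam (fun j => (c j).im) (by
      funext p
      simp only [Finset.sum_apply, Pi.smul_apply, Complex.real_smul, Pi.zero_apply]
      have : ∑ j, ((c j).im : ℂ) * lam j p
          = (∑ j, c j * lam j p - ∑ j, (starRingEnd ℂ) (c j) * lam j p) / (2 * Complex.I) := by
        rw [← Finset.sum_sub_distrib, Finset.sum_div]
        refine Finset.sum_congr rfl fun j _ => ?_
        rw [Complex.im_eq_sub_conj]; ring
      rw [this, h1, h2]; simp)
    exact fun j => Complex.ext (hre j) (him j)
  refine ⟨key, key.span_eq_top_of_card_eq_finrank' ?_⟩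
  simp [two_mul]
end

section
/- Let n ≥ 1, let U ⊆ ℂⁿ be open and connected, and let f : ℂⁿ → ℂ be holomorphic on U (complex differentiable at every point of U). Let x ∈ U be a point all of whose coordinates are real, and suppose there exists r > 0 such that every y ∈ ℂⁿ with all coordinates real and ‖y − x‖ < r lies in U and satisfies f(y) = 0. Then f vanishes identically on U. -/
theorem stmt_7_local (n : ℕ) (f : (Fin n → ℂ) → ℂ)
    (x : Fin n → ℂ) (hxreal : ∀ p, (x p).im = 0) (ρ : ℝ) (hρ : 0 < ρ)
    (hf : DifferentiableOn ℂ f (Metric.ball x ρ))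
    (hv : ∀ y ∈ Metric.ball x ρ, (∀ p, (y p).im = 0) → f y = 0) (S : Finset (Fin n)) :
    ∀ y ∈ Metric.ball x ρ, (∀ p, p ∉ S → (y p).im = 0) → f y = 0 := by
  classical
  induction S using Finset.induction_on with
  | empty => exact fun y hy h => hv y hy (fun p => h p (by simp))
  | insert p S hp ih =>
    intro y hy h
    have hmem : ∀ t ∈ Metric.ball (x p) ρ, Function.update y p t ∈ Metric.ball x ρ := by
      intro t ht
      rw [Metric.mem_ball, dist_pi_lt_iff hρ] at hy ⊢
      intro q
      by_cases hq : q = p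
      · subst hq; simpa using ht
      · simpa [hq] using hy q
    have hd : DifferentiableOn ℂ (fun t => f (Function.update y p t)) (Metric.ball (x p) ρ) := by
      refine hf.comp (t := Metric.ball x ρ) (f := fun t => Function.update y p t) ?_ hmem
      exact fun t _ => (hasFDerivAt_update y t).differentiableAt.differentiableWithinAt
    have ha := hd.analyticOnNhd Metric.isOpen_ball
    have hz := ha.eqOn_zero_of_preconnected_of_frequently_eq_zero
      (convex_ball (x p) ρ).isPreconnected (Metric.mem_ball_self hρ) (by
        have hc : Filter.Tendsto (fun s : ℝ => x p + (s : ℂ)) (nhdsWithin 0 {0}ᶜ)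
            (nhdsWithin (x p) {x p}ᶜ) := by
          apply tendsto_nhdsWithin_of_tendsto_nhds_of_eventually_within
          · have : Continuous (fun s : ℝ => x p + (s : ℂ)) := by fun_prop
            simpa using (this.tendsto 0).mono_left nhdsWithin_le_nhds
          · filter_upwards [self_mem_nhdsWithin] with s hs
            simpa using hs
        refine hc.frequently (Filter.Eventually.frequently ?_)
        have hb : ∀ᶠ s : ℝ in nhdsWithin 0 {0}ᶜ, s ∈ Metric.ball (0:ℝ) ρ :=
          nhdsWithin_le_nhds (Metric.ball_mem_nhds 0 hρ)
        filter_upwards [hb] with s hs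
        refine ih _ (hmem _ ?_) ?_
        · simpa [dist_eq_norm] using hs
        · intro q hq
          by_cases hqp : q = p
          · subst hqp; simp [hxreal]
          · simpa [hqp] using h q (by simp [hqp, hq]))
    have hyp : y p ∈ Metric.ball (x p) ρ := by
      rw [Metric.mem_ball, dist_pi_lt_iff hρ] at hy
      exact hy p
    simpa using hz hyp

theorem stmt_7_line (n : ℕ) (f : (Fin n → ℂ) → ℂ) (z : Fin n → ℂ) (ε : ℝ)
    (hf : DifferentiableOn ℂ f (Metric.ball z ε)) (w : Fin n → ℂ) (hw : w ∈ Metric.ball z ε)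
    (h0 : ∀ᶠ y in nhds w, f y = 0) : ∀ y ∈ Metric.ball z ε, f y = 0 := by
  intro y hy
  have hL : Continuous (fun t : ℂ => w + t • (y - w)) := by fun_prop
  set A : Set ℂ := (fun t : ℂ => w + t • (y - w)) ⁻¹' Metric.ball z ε with hA
  have hAo : IsOpen A := Metric.isOpen_ball.preimage hL
  have hAc : Convex ℝ A := by
    intro s hs t ht a b ha hb hab
    have := convex_ball z ε hs ht ha hb hab
    simp only [hA, Set.mem_preimage]
    convert this using 1
    have hab' : (a : ℂ) + b = 1 := by exact_mod_cast hab
    ext q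
    simp only [Pi.add_apply, Pi.smul_apply, Pi.sub_apply, smul_eq_mul, Complex.real_smul]
    linear_combination (-(w q)) * hab'
  have hd : DifferentiableOn ℂ (fun t : ℂ => f (w + t • (y - w))) A := by
    refine hf.comp (t := Metric.ball z ε) (f := fun t : ℂ => w + t • (y - w)) ?_ (fun t ht => ht)
    fun_prop
  have h0A : (0:ℂ) ∈ A := by simpa [hA] using hw
  have h1A : (1:ℂ) ∈ A := by simpa [hA] using hy
  have hz := (hd.analyticOnNhd hAo).eqOn_zero_of_preconnected_of_eventuallyEq_zero
    hAc.isPreconnected h0A (by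
      have := hL.tendsto 0
      simp only [zero_smul, add_zero] at this
      exact this.eventually h0)
  simpa using hz h1A



/-- Identity principle along a totally real slice: if `f` is holomorphic on a
connected open set `U ⊆ ℂⁿ` and vanishes on all real points within distance `r` of a real
point `x ∈ U` (all of which lie in `U`), then `f` vanishes identically on `U`. -/
theorem stmt_7 (n : ℕ) (hn : 1 ≤ n) (U : Set (Fin n → ℂ)) (hU : IsOpen U)
    (hconn : IsConnected U) (f : (Fin n → ℂ) → ℂ) (hf : DifferentiableOn ℂ f U)
    (x : Fin n → ℂ) (hx : x ∈ U) (hxreal : ∀ p, (x p).im = 0)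
    (r : ℝ) (hr : 0 < r)
    (hvanish : ∀ y : Fin n → ℂ, (∀ p, (y p).im = 0) → dist y x < r → y ∈ U ∧ f y = 0) :
    ∀ z ∈ U, f z = 0 := by
  have key : U ⊆ {z | ∀ᶠ y in nhds z, f y = 0} := by
    apply hconn.isPreconnected.subset_of_closure_inter_subset
    · exact isOpen_setOf_eventually_nhds
    · obtain ⟨δ, hδ, hδU⟩ := Metric.isOpen_iff.1 hU x hx
      have hρ : 0 < min δ r := lt_min hδ hr
      refine ⟨x, hx, ?_⟩
      filter_upwards [Metric.ball_mem_nhds x hρ] with y hy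
      refine stmt_7_local n f x hxreal _ hρ
        (hf.mono ((Metric.ball_subset_ball (min_le_left _ _)).trans hδU)) ?_ Finset.univ y hy
        (by simp)
      intro y hy h
      exact (hvanish y h (lt_of_lt_of_le hy (min_le_right _ _))).2
    · rintro z ⟨hz, hzU⟩
      obtain ⟨ε, hε, hεU⟩ := Metric.isOpen_iff.1 hU z hzU
      obtain ⟨w, hw, hw'⟩ := Metric.mem_closure_iff.1 hz ε hε
      filter_upwards [Metric.ball_mem_nhds z hε] with y hy
      exact stmt_7_line n f z ε (hf.mono hεU) w (by rwa [Metric.mem_ball, dist_comm]) hw y hy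
  exact fun z hz => (key hz).self_of_nhds
end

section
/- Let n ≥ 1 and let L : ℂⁿ → ℂⁿ be a ℂ-linear map. Define the ℝ-linear map A : ℂⁿ → ℂⁿ by A(v) = conj(v) + L(v), where conj denotes componentwise complex conjugation. Let S = { (v, A(v)) : v ∈ ℂⁿ } ⊆ ℂⁿ × ℂⁿ be the graph of A, a real-linear subspace of ℂⁿ × ℂⁿ. Then S ∩ i·S = {0}; that is, the graph of A is a totally real subspace of ℂⁿ × ℂⁿ. -/
/-- For a `ℂ`-linear `L : ℂⁿ → ℂⁿ`, the graph of the `ℝ`-linear map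
`A(v) = conj v + L v` is a totally real subspace of `ℂⁿ × ℂⁿ`: its intersection with
`i` times itself is `{0}`. -/
theorem stmt_8 (n : ℕ) (hn : 1 ≤ n) (L : (Fin n → ℂ) →ₗ[ℂ] (Fin n → ℂ)) :
    ∀ x : (Fin n → ℂ) × (Fin n → ℂ),
      (∃ v : Fin n → ℂ, x = (v, (fun p => (starRingEnd ℂ) (v p)) + L v)) →
      (∃ w : Fin n → ℂ, x = Complex.I • ((w, (fun p => (starRingEnd ℂ) (w p)) + L w) :
        (Fin n → ℂ) × (Fin n → ℂ))) →
      x = 0 := by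
  rintro x ⟨v, hv⟩ ⟨w, hw⟩
  have h := hv.symm.trans hw
  have h1 : v = Complex.I • w := congrArg Prod.fst h
  have h2 : (fun p => (starRingEnd ℂ) (v p)) + L v
      = Complex.I • ((fun p => (starRingEnd ℂ) (w p)) + L w) := congrArg Prod.snd h
  have hw0 : w = 0 := by
    funext p
    have h3 := congrFun h2 p
    rw [h1, map_smul] at h3
    simp only [Pi.add_apply, Pi.smul_apply, smul_eq_mul, map_mul, Complex.conj_I] at h3
    have h4 : (2 * Complex.I) * (starRingEnd ℂ) (w p) = 0 := by linear_combination -h3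
    have h5 : (starRingEnd ℂ) (w p) = 0 := by
      rcases mul_eq_zero.mp h4 with h6 | h6
      · exact absurd h6 (mul_ne_zero two_ne_zero Complex.I_ne_zero)
      · exact h6
    exact (map_eq_zero (starRingEnd ℂ)).mp h5
  have hv0 : v = 0 := by rw [h1, hw0, smul_zero]
  rw [hv, hv0, map_zero]
  ext p <;> simp
end
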